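/- Let f : ℝ → ℝ be a semialgebraic function that maps every integer to an integer. Then there exist a real number N and a polynomial P with real coefficients such that f(x) = P(x) for all x ∈ [N, +∞). -/

import Mathlib

/-- A basic semialgebraic subset of `ℝⁿ`: the solution set of finitely many
polynomial equations `p = 0` and strict polynomial inequalities `q > 0`. -/
def IsBasicSemialgebraic {n : ℕ} (s : Set (Fin n → ℝ)) : Prop :=
  ∃ P Q : Finset (MvPolynomial (Fin n) ℝ),
    s = {x : Fin n → ℝ |
      (∀ p ∈ P, MvPolynomial.eval x p = 0) ∧
      ∀ q ∈ Q, 0 < MvPolynomial.eval x q}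

/-- A semialgebraic subset of `ℝⁿ`: a finite union of basic semialgebraic
sets. -/
def IsSemialgebraicSet {n : ℕ} (s : Set (Fin n → ℝ)) : Prop :=
  ∃ F : Finset (Set (Fin n → ℝ)),
    (∀ t ∈ F, IsBasicSemialgebraic t) ∧ s = ⋃ t ∈ F, t

/-- A function `f : ℝ → ℝ` is semialgebraic if its graph
`{(x, f x) : x ∈ ℝ} ⊆ ℝ²` is a semialgebraic set. -/
def IsSemialgebraicFun (f : ℝ → ℝ) : Prop :=
  IsSemialgebraicSet {x : Fin 2 → ℝ | x 1 = f (x 0)}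

open Polynomial Filter Topology
open scoped Polynomial.Bivariate fwdDiff

/-- A function `f : ℝ → ℝ` is algebraic if `(x, f x)` lies on a fixed plane algebraic curve. -/
def IsAlgebraicFun (f : ℝ → ℝ) : Prop :=
  ∃ G : ℝ[X][Y], G ≠ 0 ∧ ∀ x, G.evalEval x (f x) = 0

/-- Evaluation of polynomials as a ring homomorphism into functions. -/
noncomputable def polynomialToFun : ℝ[X] →+* (ℝ → ℝ) :=
  RingHom.pi fun x ↦ evalRingHom x

lemma isAlgebraicFun_iff_isAlgebraic (f : ℝ → ℝ) :
    IsAlgebraicFun f ↔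
      @IsAlgebraic ℝ[X] (ℝ → ℝ) _ _ polynomialToFun.toAlgebra f := by
  let := polynomialToFun.toAlgebra
  refine exists_congr fun G ↦ and_congr_right fun _ ↦ ?_
  have key (x : ℝ) : (aeval f G) x = G.evalEval x (f x) := by
    have h : (Pi.evalRingHom (fun _ : ℝ ↦ ℝ) x).comp (aeval f : ℝ[X][Y] →ₐ[ℝ[X]] (ℝ → ℝ)).toRingHom
        = evalEvalRingHom x (f x) := by
      refine Polynomial.ringHom_ext' ?_ ?_
      · ext a
        · simp
        · simp [RingHom.algebraMap_toAlgebra, polynomialToFun, RingHom.pi]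
      · simp
    exact congr($h G)
  simp only [funext_iff, key, Pi.zero_apply]

lemma IsAlgebraicFun.sub {f g : ℝ → ℝ} (hf : IsAlgebraicFun f) (hg : IsAlgebraicFun g) :
    IsAlgebraicFun (f - g) := by
  let := polynomialToFun.toAlgebra
  rw [isAlgebraicFun_iff_isAlgebraic] at *
  exact IsAlgebraic.sub hf hg

lemma isAlgebraicFun_polynomial (P : ℝ[X]) : IsAlgebraicFun fun x ↦ P.eval x :=
  ⟨X - C P, X_sub_C_ne_zero P, fun x ↦ by
    rw [evalEval_sub, evalEval_X, evalEval_C, sub_self]⟩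

lemma IsAlgebraicFun.comp_add_one {f : ℝ → ℝ} (hf : IsAlgebraicFun f) :
    IsAlgebraicFun fun x ↦ f (x + 1) := by
  obtain ⟨G, hG, h⟩ := hf
  refine ⟨G.map (algEquivAevalXAddC (1 : ℝ)).toRingEquiv.toRingHom, ?_, fun x ↦ ?_⟩
  · exact (Polynomial.map_ne_zero_iff (algEquivAevalXAddC (1 : ℝ)).injective).2 hG
  · have h' : (evalEvalRingHom x (f (x + 1))).comp
        (mapRingHom (algEquivAevalXAddC (1 : ℝ)).toRingEquiv.toRingHom)
        = evalEvalRingHom (x + 1) (f (x + 1)) := by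
      refine Polynomial.ringHom_ext' ?_ ?_
      · ext a <;> simp
      · simp
    exact (congr($h' G)).trans (h (x + 1))

lemma IsAlgebraicFun.fwdDiff {f : ℝ → ℝ} (hf : IsAlgebraicFun f) :
    IsAlgebraicFun (Δ_[1] f) :=
  hf.comp_add_one.sub hf

/-- An algebraic function continuous near `+∞` is eventually zero or eventually of constant sign. -/
lemma IsAlgebraicFun.eventually_sign {g : ℝ → ℝ} (hg : IsAlgebraicFun g)
    (hc : ∃ N, ContinuousOn g (Set.Ioi N)) :
    (∀ᶠ x in atTop, g x = 0) ∨ (∀ᶠ x in atTop, 0 < g x) ∨ ∀ᶠ x in atTop, g x < 0 := by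
  obtain ⟨G, hG, h⟩ := hg
  obtain ⟨N₀, hN₀⟩ := hc
  obtain ⟨H, hGH, hH⟩ := G.exists_eq_pow_rootMultiplicity_mul_and_not_dvd hG 0
  rw [C_0, sub_zero] at hGH hH
  rw [X_dvd_iff] at hH
  obtain ⟨N₁, hN₁⟩ := eventually_atTop.1 (eventually_atTop_not_isRoot _ hH)
  set N := max N₀ N₁
  have hcont : ContinuousOn g (Set.Ioi N) := hN₀.mono (Set.Ioi_subset_Ioi (le_max_left _ _))
  have hHc : ContinuousOn (fun x ↦ H.evalEval x (g x)) (Set.Ioi N) := by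
    simp only [evalEval, eval_eq_sum_range (p := H), eval_finsetSum, eval_mul, eval_pow, eval_C]
    exact continuousOn_finsetSum _ fun i _ ↦ (Polynomial.continuousOn _).mul (hcont.pow _)
  have hU := hcont.isOpen_inter_preimage isOpen_Ioi (isOpen_compl_singleton (x := (0 : ℝ)))
  have hV := hHc.isOpen_inter_preimage isOpen_Ioi (isOpen_compl_singleton (x := (0 : ℝ)))
  have hIoi : Set.Ioi N ∈ (atTop : Filter ℝ) := Ioi_mem_atTop N
  have hdisj : Disjoint (Set.Ioi N ∩ g ⁻¹' {0}ᶜ)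
      (Set.Ioi N ∩ (fun x ↦ H.evalEval x (g x)) ⁻¹' {0}ᶜ) := by
    rw [Set.disjoint_left]
    rintro x ⟨_, hx⟩ ⟨_, hx'⟩
    have := h x
    rw [hGH, evalEval_mul, evalEval_pow, evalEval_X] at this
    exact mul_ne_zero (pow_ne_zero _ hx) hx' this
  have hcov : Set.Ioi N ⊆ (Set.Ioi N ∩ g ⁻¹' {0}ᶜ) ∪
      (Set.Ioi N ∩ (fun x ↦ H.evalEval x (g x)) ⁻¹' {0}ᶜ) := by
    intro x hx
    by_cases hgx : g x = 0
    · refine .inr ⟨hx, ?_⟩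
      have := hN₁ x ((le_max_right _ _).trans (le_of_lt hx))
      simpa [hgx, evalEval, IsRoot, coeff_zero_eq_eval_zero] using this
    · exact .inl ⟨hx, hgx⟩
  rcases isPreconnected_Ioi.subset_or_subset hU hV hdisj hcov with hs | hs
  · right
    have hne : ∀ x ∈ Set.Ioi N, g x ≠ 0 := fun x hx ↦ (hs hx).2
    by_contra hcon
    simp only [not_or, not_eventually, not_lt] at hcon
    obtain ⟨x, hx, hxN⟩ := (hcon.1.and_eventually hIoi).exists
    obtain ⟨y, hy, hyN⟩ := (hcon.2.and_eventually hIoi).exists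
    obtain ⟨z, hz, hz0⟩ := isPreconnected_Ioi.intermediate_value hxN hyN hcont ⟨hx, hy⟩
    exact hne z hz hz0
  · left
    filter_upwards [hIoi] with x hx
    by_contra hgx
    exact Set.disjoint_left.1 hdisj ⟨hx, hgx⟩ (hs hx)

/-- An algebraic function is eventually dominated by a polynomial. -/
lemma IsAlgebraicFun.exists_polynomial_bound {f : ℝ → ℝ} (hf : IsAlgebraicFun f) :
    ∃ Q : ℝ[X], ∀ᶠ x in atTop, |f x| ≤ Q.eval x := by
  obtain ⟨G, hG, h⟩ := hf
  have hlc : G.leadingCoeff ≠ 0 := leadingCoeff_ne_zero.2 hG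
  obtain ⟨M, hM⟩ := ((Polynomial.isBigO_atTop_of_degree_le (1 : ℝ[X]) G.leadingCoeff
    (by simpa using zero_le_degree_iff.2 hlc))).bound
  have hroot := eventually_atTop_not_isRoot _ hlc
  refine ⟨∑ i ∈ Finset.range G.natDegree, C M * (G.coeff i ^ 2 + 1) + 1, ?_⟩
  filter_upwards [hM, hroot] with x hMx hrx
  set p := G.map (evalRingHom x)
  have hlx : G.leadingCoeff.eval x ≠ 0 := hrx
  have hdeg : p.natDegree = G.natDegree := natDegree_map_of_leadingCoeff_ne_zero _ hlx
  have hp : p.leadingCoeff = G.leadingCoeff.eval x := leadingCoeff_map_of_leadingCoeff_ne_zero _ hlx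
  have hp0 : p ≠ 0 := by rintro h0; rw [h0, leadingCoeff_zero] at hp; exact hlx hp.symm
  have hpr : p.IsRoot (f x) := (map_evalRingHom_eval x (f x) G).trans (h x)
  have hb := hpr.norm_lt_cauchyBound hp0
  rw [cauchyBound, hdeg, hp] at hb
  rw [eval_one, norm_one] at hMx
  have hpos : 0 < ‖G.leadingCoeff.eval x‖ := norm_pos_iff.2 hlx
  have h1 : (1 : ℝ) / ‖G.leadingCoeff.eval x‖ ≤ M := by rwa [div_le_iff₀ hpos]
  have hM0 : 0 ≤ M := le_trans (by positivity) h1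
  have hsup : (((Finset.range G.natDegree).sup (‖p.coeff ·‖₊) : NNReal) : ℝ) ≤
      ∑ i ∈ Finset.range G.natDegree, ((G.coeff i).eval x ^ 2 + 1) := by
    have : (Finset.range G.natDegree).sup (‖p.coeff ·‖₊) ≤
        ∑ i ∈ Finset.range G.natDegree, ‖p.coeff i‖₊ :=
      Finset.sup_le fun i hi ↦ Finset.single_le_sum (f := fun i ↦ ‖p.coeff i‖₊)
        (fun _ _ ↦ zero_le) hi
    refine (NNReal.coe_le_coe.2 this).trans ?_
    rw [NNReal.coe_sum]
    refine Finset.sum_le_sum fun i _ ↦ ?_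
    rw [coe_nnnorm, coeff_map, coe_evalRingHom, Real.norm_eq_abs, abs_le]
    constructor <;> nlinarith [sq_nonneg ((G.coeff i).eval x - 1), sq_nonneg ((G.coeff i).eval x + 1)]
  rw [← Real.norm_eq_abs, ← coe_nnnorm]
  refine (NNReal.coe_lt_coe.2 hb).le.trans ?_
  rw [NNReal.coe_add, NNReal.coe_div, NNReal.coe_one, coe_nnnorm]
  rw [eval_add, eval_finsetSum, eval_one]
  simp only [eval_mul, eval_C, eval_add, eval_pow, eval_one]
  rw [← Finset.mul_sum]
  gcongr
  rw [div_eq_mul_one_div, mul_comm]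
  exact mul_le_mul h1 hsup (NNReal.coe_nonneg _) hM0

lemma exists_lower_bound_of_fwdDiff_iter_nonneg (k : ℕ) (b : ℝ → ℝ)
    (hb : ∀ᶠ m : ℕ in atTop, 0 ≤ (Δ_[1])^[k + 1] b m) :
    ∃ C : ℝ, ∀ m : ℕ, -C * (m + 1) ^ k ≤ b m := by
  induction k generalizing b with
  | zero =>
    obtain ⟨M, hM⟩ := eventually_atTop.1 hb
    refine ⟨∑ i ∈ Finset.range (M + 1), |b i|, fun m ↦ ?_⟩
    have hsmall (m : ℕ) (hm : m ≤ M) : -∑ i ∈ Finset.range (M + 1), |b i| ≤ b m := by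
      have := Finset.single_le_sum (f := fun i : ℕ ↦ |b i|) (fun _ _ ↦ abs_nonneg _)
        (Finset.mem_range.2 (Nat.lt_succ_of_le hm))
      linarith [neg_abs_le (b m)]
    rw [pow_zero, mul_one]
    rcases le_total m M with hm | hm
    · exact hsmall m hm
    · induction m, hm using Nat.le_induction with
      | base => exact hsmall M le_rfl
      | succ m hm ih =>
        have := hM m hm
        simp only [zero_add, Function.iterate_one, fwdDiff] at this
        push_cast
        linarith
  | succ k ih =>
    obtain ⟨C, hC⟩ := ih (Δ_[1] b) hb
    have hC0 : 0 ≤ |C| := abs_nonneg C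
    refine ⟨|C| + |b 0|, fun m ↦ ?_⟩
    have key : -|b 0| - |C| * m * (m + 1) ^ k ≤ b m := by
      induction m with
      | zero => simpa using neg_abs_le (b 0)
      | succ m ihm =>
        have h1 := hC m
        simp only [fwdDiff] at h1
        have h2 : (m + 1 : ℝ) ^ k ≤ (m + 1 + 1 : ℝ) ^ k := by gcongr; linarith
        have h3 : 0 ≤ |C| * m := by positivity
        have h4 : C * (m + 1 : ℝ) ^ k ≤ |C| * (m + 1 : ℝ) ^ k := by gcongr; exact le_abs_self C
        push_cast
        nlinarith [mul_le_mul_of_nonneg_left h2 h3, mul_le_mul_of_nonneg_left h2 hC0]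
    have h5 : (1 : ℝ) ≤ (m + 1 : ℝ) ^ (k + 1) := one_le_pow₀ (by linarith [m.cast_nonneg (α := ℝ)])
    have h6 : 0 ≤ |C| * (m + 1 : ℝ) ^ k := by positivity
    rw [pow_succ] at h5 ⊢
    nlinarith [mul_le_mul_of_nonneg_left h5 (abs_nonneg (b 0))]

/-- A function whose `(k+1)`-st differences are at least `1` grows faster than any polynomial of
degree at most `k`. -/
lemma not_le_polynomial_of_one_le_fwdDiff_iter {k : ℕ} {a : ℝ → ℝ} {Q : ℝ[X]}
    (hQ : Q.natDegree ≤ k) (ha : ∀ᶠ m : ℕ in atTop, 1 ≤ (Δ_[1])^[k + 1] a m) :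
    ¬ ∀ᶠ m : ℕ in atTop, a m ≤ Q.eval (m : ℝ) := by
  intro haQ
  set r : ℝ := ((k + 1).factorial : ℝ)⁻¹
  have hr : 0 < r := by positivity
  have hdiff (x : ℝ) : (Δ_[1])^[k + 1] (a + (-r) • fun x : ℝ ↦ x ^ (k + 1)) x
      = (Δ_[1])^[k + 1] a x - 1 := by
    rw [fwdDiff_iter_add, fwdDiff_iter_const_smul, fwdDiff_iter_eq_factorial]
    simp [r, Nat.factorial_ne_zero, sub_eq_add_neg]
  obtain ⟨C₀, hC⟩ := exists_lower_bound_of_fwdDiff_iter_nonneg k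
    (a + (-r) • fun x : ℝ ↦ x ^ (k + 1)) (by
      filter_upwards [ha] with m hm
      rw [hdiff]
      linarith)
  set P : ℝ[X] := Q + C C₀ * (X + 1) ^ k
  have hP : P.degree < (C r * X ^ (k + 1) : ℝ[X]).degree := by
    rw [degree_C_mul_X_pow _ hr.ne']
    have : P.natDegree ≤ k := natDegree_add_le_of_degree_le hQ (by compute_degree)
    exact (degree_le_of_natDegree_le this).trans_lt (by exact_mod_cast Nat.lt_succ_self k)
  have hlim := ((Polynomial.div_tendsto_atTop_zero_of_degree_lt _ _ hP).comp
    tendsto_natCast_atTop_atTop).eventually (gt_mem_nhds (zero_lt_one' ℝ))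
  obtain ⟨m, hm, hm1, hm0⟩ := (hlim.and (haQ.and (eventually_gt_atTop 0))).exists
  have hpos : 0 < r * (m : ℝ) ^ (k + 1) := by positivity
  have h1 := hC m
  simp only [Function.comp_apply, eval_mul, eval_C, eval_pow, eval_X] at hm
  rw [div_lt_one hpos] at hm
  simp [P] at hm
  simp at h1
  linarith

/-- A function with eventually vanishing `k`-th differences along the integers
agrees with a polynomial at all large integers. -/
lemma exists_polynomial_of_fwdDiff_iter_eq_zero {k : ℕ} {a : ℝ → ℝ}
    (ha : ∀ᶠ m : ℕ in atTop, (Δ_[1])^[k] a m = 0) :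
    ∃ P : ℝ[X], ∀ᶠ m : ℕ in atTop, a m = P.eval (m : ℝ) := by
  induction k generalizing a with
  | zero => exact ⟨0, by simpa using ha⟩
  | succ k ih =>
    obtain ⟨M, hM⟩ := eventually_atTop.1 ha
    set c : ℝ := (Δ_[1])^[k] a M / (k.factorial : ℝ)
    have hconst (m : ℕ) (hm : M ≤ m) : (Δ_[1])^[k] a m = (Δ_[1])^[k] a M := by
      induction m, hm using Nat.le_induction with
      | base => rfl
      | succ m hm ih =>
        have := hM m hm
        rw [Function.iterate_succ_apply', fwdDiff, sub_eq_zero] at this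
        rw [← ih, ← this, Nat.cast_add_one]
    obtain ⟨P, hP⟩ := ih (a := a + (-c) • fun x : ℝ ↦ x ^ k) (by
      filter_upwards [eventually_ge_atTop M] with m hm
      rw [fwdDiff_iter_add, fwdDiff_iter_const_smul, fwdDiff_iter_eq_factorial, Pi.add_apply,
        hconst m hm]
      simp [c, Nat.factorial_ne_zero])
    refine ⟨P + C c * X ^ k, ?_⟩
    filter_upwards [hP] with m hm
    simp only [Pi.add_apply, Pi.smul_apply, smul_eq_mul] at hm
    simp only [eval_add, eval_mul, eval_C, eval_pow, eval_X]
    linarith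

/-- An irreducible bivariate polynomial and one it does not divide generate an ideal
containing a nonzero constant. -/
lemma Irreducible.exists_mul_add_mul_eq_C {R : Type*} [CommRing R] [IsDomain R]
    [UniqueFactorizationMonoid R] {π p : R[X]} (hπ : Irreducible π) (hp : ¬ π ∣ p) :
    ∃ (a b : R[X]) (d : R), d ≠ 0 ∧ a * π + b * p = C d := by
  have := AdjoinRoot.isDomain_of_prime hπ.prime
  have hroot : IsAlgebraic R (AdjoinRoot.root π) := AdjoinRoot.isAlgebraic_root hπ.ne_zero
  have halg : IsAlgebraic R (AdjoinRoot.mk π p) := by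
    have := Algebra.isAlgebraic_adjoin_singleton_iff.2 hroot
    exact this _ (by rw [AdjoinRoot.adjoinRoot_eq_top]; trivial)
  obtain ⟨d, hd, t, ht⟩ := halg.exists_nonzero_dvd
    (mem_nonZeroDivisors_of_ne_zero (by rwa [Ne, AdjoinRoot.mk_eq_zero]))
  obtain ⟨b, rfl⟩ := AdjoinRoot.mk_surjective t
  have : AdjoinRoot.mk π (C d - p * b) = 0 := by
    rw [map_sub, map_mul, ← ht, AdjoinRoot.mk_C, AdjoinRoot.algebraMap_eq, sub_self]
  obtain ⟨a, ha⟩ := AdjoinRoot.mk_eq_zero.1 this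
  exact ⟨a, b, d, hd, by linear_combination -ha⟩

lemma Irreducible.eventually_dvd_of_evalEval_eq_zero {π : ℝ[X][Y]} (hπ : Irreducible π)
    (p : ℝ[X][Y]) :
    ∀ᶠ x in atTop, ∀ y, π.evalEval x y = 0 → p.evalEval x y = 0 → π ∣ p := by
  by_cases hp : π ∣ p
  · exact .of_forall fun _ _ _ _ ↦ hp
  obtain ⟨a, b, d, hd, h⟩ := hπ.exists_mul_add_mul_eq_C hp
  filter_upwards [eventually_atTop_not_isRoot d hd] with x hx y h1 h2
  have := congr(evalEval x y $h)
  rw [evalEval_add, evalEval_mul, evalEval_mul, h1, h2, evalEval_C] at this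
  exact absurd (by simpa using this.symm) hx

/-- For large `x`, all real roots of `π(x, ·)` are simple. -/
lemma Irreducible.eventually_evalEval_derivative_ne_zero {π : ℝ[X][Y]} (hπ : Irreducible π) :
    ∀ᶠ x in atTop, ∀ y, π.evalEval x y = 0 → (derivative π).evalEval x y ≠ 0 := by
  by_cases hd : derivative π = 0
  · obtain ⟨c, rfl⟩ : ∃ c, π = C c := ⟨_, eq_C_of_derivative_eq_zero hd⟩
    have hc : c ≠ 0 := by rintro rfl; exact hπ.ne_zero C_0
    filter_upwards [eventually_atTop_not_isRoot c hc] with x hx y h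
    rw [evalEval_C] at h
    exact absurd h hx
  · filter_upwards [hπ.eventually_dvd_of_evalEval_eq_zero (derivative π)] with x hx y h1 h2
    exact not_dvd_of_degree_lt hd (degree_derivative_lt hπ.ne_zero) (hx y h1 h2)

/-- The bivariate polynomial `p(X, Y)` corresponding to a polynomial in two variables. -/
noncomputable def MvPolynomial.toBivariate : MvPolynomial (Fin 2) ℝ →ₐ[ℝ] ℝ[X][Y] :=
  MvPolynomial.aeval ![Polynomial.C Polynomial.X, Polynomial.X]

lemma MvPolynomial.evalEval_toBivariate (p : MvPolynomial (Fin 2) ℝ) (x y : ℝ) :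
    (toBivariate p).evalEval x y = MvPolynomial.eval ![x, y] p := by
  have h : (evalEvalRingHom x y).comp toBivariate.toRingHom = MvPolynomial.eval ![x, y] := by
    refine MvPolynomial.ringHom_ext (fun r ↦ ?_) fun i ↦ ?_
    · simp [toBivariate, IsScalarTower.algebraMap_apply ℝ ℝ[X] ℝ[X][Y]]
    · fin_cases i <;> simp [toBivariate]
  exact congr($h p)

lemma MvPolynomial.toBivariate_ne_zero {p : MvPolynomial (Fin 2) ℝ} (hp : p ≠ 0) :
    toBivariate p ≠ 0 := by
  contrapose! hp
  refine MvPolynomial.funext fun v ↦ ?_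
  have hv : v = ![v 0, v 1] := by ext i; fin_cases i <;> rfl
  rw [hv, ← evalEval_toBivariate, hp, evalEval_zero, map_zero]

lemma continuous_evalEval (p : ℝ[X][Y]) : Continuous fun v : ℝ × ℝ ↦ p.evalEval v.1 v.2 := by
  simp only [evalEval, eval_eq_sum_range (p := p), eval_finsetSum, eval_mul, eval_pow, eval_C]
  exact continuous_finsetSum _ fun i _ ↦
    ((Polynomial.continuous _).comp continuous_fst).mul (continuous_snd.pow i)

/-- A description of the graph of a semialgebraic function by bivariate polynomials. -/
lemma IsSemialgebraicFun.exists_finset {f : ℝ → ℝ} (hf : IsSemialgebraicFun f) :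
    ∃ F : Finset (Finset ℝ[X][Y] × Finset ℝ[X][Y]),
      ∀ x y, y = f x ↔ ∃ t ∈ F, (∀ p ∈ t.1, p.evalEval x y = 0) ∧
        ∀ q ∈ t.2, 0 < q.evalEval x y := by
  classical
  obtain ⟨F, hF, hgraph⟩ := hf
  choose! P Q hPQ using hF
  refine ⟨F.image fun t ↦ ((P t).image MvPolynomial.toBivariate,
    (Q t).image MvPolynomial.toBivariate), fun x y ↦ ?_⟩
  have h1 : y = f x ↔ ![x, y] ∈ {v : Fin 2 → ℝ | v 1 = f (v 0)} := by simp
  rw [h1, hgraph]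
  simp only [Set.mem_iUnion, exists_prop, Finset.exists_mem_image, Finset.forall_mem_image,
    MvPolynomial.evalEval_toBivariate]
  refine exists_congr fun t ↦ and_congr_right fun ht ↦ ?_
  conv_lhs => rw [hPQ t ht]
  rfl

/-- A basic set contained in a graph and nonempty involves a nontrivial equation. -/
lemma exists_ne_zero_of_forall_eq {f : ℝ → ℝ} {P Q : Finset ℝ[X][Y]} {x : ℝ}
    (hsub : ∀ y, (∀ p ∈ P, p.evalEval x y = 0) → (∀ q ∈ Q, 0 < q.evalEval x y) → y = f x)
    (hQ : ∀ q ∈ Q, 0 < q.evalEval x (f x)) : ∃ p ∈ P, p ≠ 0 := by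
  by_contra! hP
  have hev : ∀ᶠ y in 𝓝 (f x), y = f x := by
    have : ∀ᶠ y in 𝓝 (f x), ∀ q ∈ Q, 0 < q.evalEval x y := by
      rw [Filter.eventually_all_finset]
      intro q hq
      have hc : Continuous fun y ↦ q.evalEval x y :=
        (continuous_evalEval q).comp (Continuous.prodMk_right x)
      exact hc.continuousAt.eventually (lt_mem_nhds (hQ q hq))
    filter_upwards [this] with y hy
    exact hsub y (fun p hp ↦ by rw [hP p hp, evalEval_zero]) hy
  obtain ⟨y, hy, hne⟩ := ((hev.filter_mono nhdsWithin_le_nhds).and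
    (self_mem_nhdsWithin (a := f x) (s := {f x}ᶜ))).exists
  exact hne hy

lemma IsSemialgebraicFun.isAlgebraicFun {f : ℝ → ℝ} (hf : IsSemialgebraicFun f) :
    IsAlgebraicFun f := by
  classical
  obtain ⟨F, hF⟩ := hf.exists_finset
  refine ⟨∏ t ∈ F, ∏ p ∈ t.1 with p ≠ 0, p, ?_, fun x ↦ ?_⟩
  · simp +contextual [Finset.prod_ne_zero_iff]
  · obtain ⟨t, ht, hP, hQ⟩ := (hF x (f x)).1 rfl
    obtain ⟨p, hp, hp0⟩ := exists_ne_zero_of_forall_eq (P := t.1)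
      (fun y h1 h2 ↦ (hF x y).2 ⟨t, ht, h1, h2⟩) hQ
    rw [evalEval_prod]
    refine Finset.prod_eq_zero ht ?_
    rw [evalEval_prod]
    exact Finset.prod_eq_zero (Finset.mem_filter.2 ⟨hp, hp0⟩) (hP p hp)

/-- Near a simple root `y` of `π(x, ·)`, the polynomial `π(x', ·)` with `x'` close to `x`
has a root close to `y`. -/
lemma eventually_exists_root_of_simple {π : ℝ[X][Y]} {x y : ℝ} (h0 : π.evalEval x y = 0)
    (h1 : (derivative π).evalEval x y ≠ 0) {s : Set ℝ} (hs : s ∈ 𝓝 y) :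
    ∀ᶠ x' in 𝓝 x, ∃ y' ∈ s, π.evalEval x' y' = 0 := by
  wlog hpos : 0 < (derivative π).evalEval x y generalizing π
  · have := this (π := -π) (by rw [evalEval_neg, h0, neg_zero])
      (by rwa [derivative_neg, evalEval_neg, neg_ne_zero])
      (by
        rw [derivative_neg, evalEval_neg, neg_pos]
        exact lt_of_le_of_ne (not_lt.1 hpos) h1)
    simpa [evalEval_neg] using this
  have hder : HasDerivAt (fun z ↦ π.evalEval x z) ((derivative π).evalEval x y) y := by
    simp only [← map_evalRingHom_eval, ← derivative_map]
    exact Polynomial.hasDerivAt _ _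
  have hslope := hder.tendsto_slope.eventually (lt_mem_nhds hpos)
  obtain ⟨ε, hε, hball⟩ := Metric.mem_nhds_iff.1
    (inter_mem hs (eventually_nhdsWithin_iff.1 hslope))
  have hmem {z : ℝ} (hz : |z - y| < ε) : z ∈ s ∧ (z ≠ y → 0 < slope (fun z ↦ π.evalEval x z) y z) :=
    hball (by rwa [Metric.mem_ball, Real.dist_eq])
  set a := y - ε / 2
  set b := y + ε / 2
  have ha : π.evalEval x a < 0 := by
    have := (hmem (z := a) (by rw [abs_lt]; constructor <;> simp only [a] <;> linarith)).2
      (by simp only [a]; linarith)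
    rw [slope_def_field, h0, sub_zero] at this
    rcases div_pos_iff.1 this with h | h
    · simp only [a] at h
      linarith [h.2]
    · exact h.1
  have hb : 0 < π.evalEval x b := by
    have := (hmem (z := b) (by rw [abs_lt]; constructor <;> simp only [b] <;> linarith)).2
      (by simp only [b]; linarith)
    rw [slope_def_field, h0, sub_zero] at this
    rcases div_pos_iff.1 this with h | h
    · exact h.1
    · simp only [b] at h
      linarith [h.2]
  have hcx (z : ℝ) : Continuous fun x' ↦ π.evalEval x' z :=
    (continuous_evalEval π).comp (Continuous.prodMk_left z)
  filter_upwards [(hcx a).continuousAt.eventually (gt_mem_nhds ha),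
    (hcx b).continuousAt.eventually (lt_mem_nhds hb)] with x' hxa hxb
  have hcy : Continuous fun z ↦ π.evalEval x' z :=
    (continuous_evalEval π).comp (Continuous.prodMk_right x')
  obtain ⟨z, hz, hz0⟩ := intermediate_value_Icc (by simp only [a, b]; linarith : a ≤ b)
    hcy.continuousOn ⟨hxa.le, hxb.le⟩
  refine ⟨z, (hmem ?_).1, hz0⟩
  simp only [a, b] at hz
  rw [abs_lt]
  constructor <;> linarith [hz.1, hz.2]

/-- A semialgebraic function is continuous near `+∞`. -/
lemma IsSemialgebraicFun.exists_continuousOn {f : ℝ → ℝ} (hf : IsSemialgebraicFun f) :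
    ∃ N, ContinuousOn f (Set.Ioi N) := by
  classical
  obtain ⟨F, hF⟩ := hf.exists_finset
  set S : Finset ℝ[X][Y] := F.biUnion fun t ↦ t.1
  set I : Finset ℝ[X][Y] := S.biUnion fun p ↦ (UniqueFactorizationMonoid.factors p).toFinset
  have hI : ∀ π ∈ I, Irreducible π := by
    intro π hπ
    obtain ⟨p, -, hp⟩ := Finset.mem_biUnion.1 hπ
    exact UniqueFactorizationMonoid.irreducible_of_factor _ (Multiset.mem_toFinset.1 hp)
  have hdvd : ∀ᶠ x in atTop, ∀ π ∈ I, ∀ p ∈ S, ∀ y,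
      π.evalEval x y = 0 → p.evalEval x y = 0 → π ∣ p := by
    simp only [Filter.eventually_all_finset]
    exact fun π hπ p _ ↦ (hI π hπ).eventually_dvd_of_evalEval_eq_zero p
  have hder : ∀ᶠ x in atTop, ∀ π ∈ I, ∀ y,
      π.evalEval x y = 0 → (derivative π).evalEval x y ≠ 0 := by
    simp only [Filter.eventually_all_finset]
    exact fun π hπ ↦ (hI π hπ).eventually_evalEval_derivative_ne_zero
  obtain ⟨N, hN⟩ := eventually_atTop.1 (hdvd.and hder)
  refine ⟨N, fun x hx ↦ ContinuousAt.continuousWithinAt ?_⟩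
  obtain ⟨hdvdx, hderx⟩ := hN x (le_of_lt hx)
  obtain ⟨t, ht, hP, hQ⟩ := (hF x (f x)).1 rfl
  obtain ⟨p, hp, hp0⟩ := exists_ne_zero_of_forall_eq (P := t.1)
    (fun y h1 h2 ↦ (hF x y).2 ⟨t, ht, h1, h2⟩) hQ
  have hS : ∀ p ∈ t.1, p ∈ S := fun p hp ↦ Finset.mem_biUnion.2 ⟨t, ht, hp⟩
  obtain ⟨π, hπ, hπ0⟩ : ∃ π ∈ I, π.evalEval x (f x) = 0 := by
    have h1 := (UniqueFactorizationMonoid.factors_prod hp0).dvd'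
    have h2 := evalEval_dvd x (f x) h1
    rw [hP p hp, evalEval_multiset_prod, zero_dvd_iff, Multiset.prod_eq_zero_iff,
      Multiset.mem_map] at h2
    obtain ⟨π, hπ, hπ0⟩ := h2
    exact ⟨π, Finset.mem_biUnion.2 ⟨p, hS p hp, Multiset.mem_toFinset.2 hπ⟩, hπ0⟩
  have hQev : ∀ᶠ v in 𝓝 (x, f x), ∀ q ∈ t.2, 0 < q.evalEval v.1 v.2 := by
    rw [Filter.eventually_all_finset]
    exact fun q hq ↦ (continuous_evalEval q).continuousAt.eventually (lt_mem_nhds (hQ q hq))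
  obtain ⟨U, hU, V, hV, hUV⟩ := mem_nhds_prod_iff.1 hQev
  refine fun W hW ↦ mem_map.2 ?_
  filter_upwards [hU, eventually_exists_root_of_simple hπ0 (hderx π hπ _ hπ0)
    (inter_mem hV hW)] with x' hx' ⟨y', ⟨hyV, hyW⟩, hy'⟩
  have hy : y' = f x' := (hF x' y').2 ⟨t, ht, fun p hp ↦ ?_, hUV (Set.mk_mem_prod hx' hyV)⟩
  · rwa [Set.mem_preimage, ← hy]
  · have := evalEval_dvd x' y' (hdvdx π hπ p (hS p hp) _ hπ0 (hP p hp))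
    rwa [hy', zero_dvd_iff] at this

/-- Algebraicity, continuity near `+∞` and integrality on `ℤ` pass to iterated differences. -/
lemma fwdDiff_iter_induction {f : ℝ → ℝ} (ha : IsAlgebraicFun f)
    (hc : ∃ N, ContinuousOn f (Set.Ioi N)) (hint : ∀ m : ℤ, ∃ k : ℤ, f m = k) (n : ℕ) :
    IsAlgebraicFun ((Δ_[1])^[n] f) ∧ (∃ N, ContinuousOn ((Δ_[1])^[n] f) (Set.Ioi N)) ∧
      ∀ m : ℤ, ∃ k : ℤ, (Δ_[1])^[n] f m = k := by
  induction n with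
  | zero => exact ⟨ha, hc, hint⟩
  | succ n ih =>
    rw [Function.iterate_succ_apply']
    obtain ⟨ha, ⟨N, hN⟩, hint⟩ := ih
    refine ⟨ha.fwdDiff, ⟨N, ?_⟩, fun m ↦ ?_⟩
    · refine (hN.comp (by fun_prop) fun x hx ↦ ?_).sub hN
      exact lt_trans (Set.mem_Ioi.1 hx) (lt_add_one x)
    · obtain ⟨k, hk⟩ := hint m
      obtain ⟨l, hl⟩ := hint (m + 1)
      refine ⟨l - k, ?_⟩
      push_cast at hl ⊢
      rw [fwdDiff, hl, hk]

/-- A semialgebraic function `f : ℝ → ℝ` mapping integers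
to integers coincides with a polynomial on some half-line `[N, +∞)`. -/
theorem semialgebraic_integer_valued_eventually_polynomial
    (f : ℝ → ℝ) (hf : IsSemialgebraicFun f)
    (hint : ∀ m : ℤ, ∃ k : ℤ, f (m : ℝ) = (k : ℝ)) :
    ∃ (N : ℝ) (P : Polynomial ℝ), ∀ x : ℝ, N ≤ x → f x = P.eval x := by
  have ha := hf.isAlgebraicFun
  have hc := hf.exists_continuousOn
  obtain ⟨Q, hQ⟩ := ha.exists_polynomial_bound
  have hQm : ∀ᶠ m : ℕ in atTop, |f m| ≤ Q.eval (m : ℝ) :=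
    tendsto_natCast_atTop_atTop.eventually hQ
  set n := Q.natDegree + 1
  obtain ⟨han, hcn, hintn⟩ := fwdDiff_iter_induction ha hc hint n
  have hzero : ∀ᶠ m : ℕ in atTop, (Δ_[1])^[n] f m = 0 := by
    rcases han.eventually_sign hcn with h | h | h
    · exact tendsto_natCast_atTop_atTop.eventually h
    · refine absurd (hQm.mono fun m hm ↦ (le_abs_self _).trans hm)
        (not_le_polynomial_of_one_le_fwdDiff_iter le_rfl ?_)
      filter_upwards [tendsto_natCast_atTop_atTop.eventually h] with m hm
      obtain ⟨k, hk⟩ := hintn m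
      rw [Int.cast_natCast] at hk
      rw [hk] at hm ⊢
      exact_mod_cast Int.add_one_le_of_lt (Int.cast_pos.1 hm)
    · have hneg : (Δ_[1])^[n] ((-1 : ℝ) • f) = (-1 : ℝ) • (Δ_[1])^[n] f :=
        fwdDiff_iter_const_smul 1 (-1 : ℝ) f n
      refine absurd (hQm.mono fun m hm ↦ ?_)
        (not_le_polynomial_of_one_le_fwdDiff_iter (a := (-1 : ℝ) • f) (Q := Q) le_rfl ?_)
      · simpa using (neg_le_abs _).trans hm
      filter_upwards [tendsto_natCast_atTop_atTop.eventually h] with m hm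
      obtain ⟨k, hk⟩ := hintn m
      rw [Int.cast_natCast] at hk
      rw [hneg, Pi.smul_apply, hk, smul_eq_mul, neg_one_mul]
      rw [hk] at hm
      exact_mod_cast Int.add_one_le_of_lt (neg_pos.2 (Int.cast_lt_zero.1 hm))
  obtain ⟨P, hP⟩ := exists_polynomial_of_fwdDiff_iter_eq_zero hzero
  have hzeros : ∃ᶠ x : ℝ in atTop, (f - fun x ↦ P.eval x) x = 0 :=
    tendsto_natCast_atTop_atTop.frequently
      (hP.mono fun m hm ↦ by rw [Pi.sub_apply, hm, sub_self]).frequently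
  have hcP : ∃ N, ContinuousOn (f - fun x ↦ P.eval x) (Set.Ioi N) :=
    hc.imp fun N hN ↦ hN.sub P.continuousOn
  rcases (ha.sub (isAlgebraicFun_polynomial P)).eventually_sign hcP with h | h | h
  · obtain ⟨N, hN⟩ := eventually_atTop.1 h
    exact ⟨N, P, fun x hx ↦ sub_eq_zero.1 (hN x hx)⟩
  · exact absurd (hzeros.and_eventually h).exists fun ⟨_, h1, h2⟩ ↦ h2.ne' h1
  · exact absurd (hzeros.and_eventually h).exists fun ⟨_, h1, h2⟩ ↦ h2.ne h1
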